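/- Let N ≥ 2, 1 < p < N, p < q < ∞, p* := Np/(N−p), r > p*, and a : ℤ^N → [0,∞). Then S := inf{ I(u) : u : ℤ^N → ℝ finitely supported and Σ_{x∈ℤ^N} |u(x)|^r = 1 } is positive. -/

import Mathlib

open Filter Topology
open scoped ENNReal Classical

noncomputable section

abbrev ZN (N : ℕ) := Fin N → ℤ

def adj {N : ℕ} (x y : ZN N) : Prop := (∑ i, (x i - y i).natAbs) = 1

def eInt {N : ℕ} (g : ZN N → ZN N → ℝ) : ℝ≥0∞ :=
  (∑' e : ZN N × ZN N, if adj e.1 e.2 then ENNReal.ofReal (g e.1 e.2) else 0) / 2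

def grad {N : ℕ} (u : ZN N → ℝ) (x y : ZN N) : ℝ := u y - u x

def energy {N : ℕ} (p q : ℝ) (a u : ZN N → ℝ) : ℝ≥0∞ :=
  eInt (fun x y => (1 / p) * |grad u x y| ^ p + (a x / q) * |grad u x y| ^ q)

def gradModular {N : ℕ} (p q : ℝ) (a u : ZN N → ℝ) : ℝ≥0∞ :=
  eInt (fun x y => |grad u x y| ^ p + a x * |grad u x y| ^ q)

def vsum {N : ℕ} (r : ℝ) (u : ZN N → ℝ) : ℝ≥0∞ :=
  ∑' x : ZN N, ENNReal.ofReal (|u x| ^ r)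

def Slevel {N : ℕ} (p q : ℝ) (a : ZN N → ℝ) (r t : ℝ) : ℝ≥0∞ :=
  sInf { c : ℝ≥0∞ | ∃ u : ZN N → ℝ, (Function.support u).Finite ∧
      vsum r u = ENNReal.ofReal (r * t) ∧ energy p q a u = c }

def Lop {N : ℕ} (p q : ℝ) (a u : ZN N → ℝ) (x₀ : ZN N) : ℝ :=
  -(∑' y : ZN N, if adj x₀ y then |u y - u x₀| ^ (p - 2) * (u y - u x₀) else 0)
    - ∑' y : ZN N, if adj x₀ y then
        ((a x₀ + a y) / 2) * (|u y - u x₀| ^ (q - 2) * (u y - u x₀)) else 0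

section DiscreteSobolev

open MeasureTheory Function

lemma tsum_mul_le_Lp_mul_Lq {α : Type*} [Countable α] {p q : ℝ} (hpq : p.HolderConjugate q)
    (f g : α → ℝ≥0∞) :
    ∑' x, f x * g x ≤ (∑' x, f x ^ p) ^ (1 / p) * (∑' x, g x ^ q) ^ (1 / q) := by
  let : MeasurableSpace α := ⊤
  have h := ENNReal.lintegral_mul_le_Lp_mul_Lq (Measure.count : Measure α) hpq
    (f := f) (g := g) Measurable.of_discrete.aemeasurable Measurable.of_discrete.aemeasurable
  simpa [lintegral_count] using h

lemma pi_count_eq_count (N : ℕ) :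
    Measure.pi (fun _ : Fin N => (Measure.count : Measure ℤ)) = Measure.count := by
  refine Measure.ext_of_singleton fun x => ?_
  rw [Measure.pi_singleton]
  simp

/-- The grid-lines inequality for the counting measure. -/
lemma tsum_prod_tsum_update_rpow_le {N : ℕ} (hN : 2 ≤ N) (f : ZN N → ℝ≥0∞) :
    ∑' x, ∏ i, (∑' k : ℤ, f (update x i k)) ^ (1 / ((N : ℝ) - 1)) ≤
      (∑' x, f x) ^ ((N : ℝ) / ((N : ℝ) - 1)) := by
  have hN' : (2 : ℝ) ≤ N := by exact_mod_cast hN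
  have hc : Real.HolderConjugate (Fintype.card (Fin N)) ((N : ℝ) / ((N : ℝ) - 1)) := by
    rw [Fintype.card_fin]
    exact Real.HolderConjugate.conjExponent (by linarith)
  have h := lintegral_prod_lintegral_pow_le (fun _ : Fin N => (Measure.count : Measure ℤ)) hc
    (f := f) Measurable.of_discrete
  simpa [pi_count_eq_count, lintegral_count] using h

lemma edist_zero_le_tsum_edist (g : ℤ → ℝ) (hg : (support g).Finite) (m : ℤ) :
    edist (g m) 0 ≤ ∑' k : ℤ, edist (g k) (g (k + 1)) := by
  obtain ⟨M, hM⟩ := hg.bddAbove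
  obtain ⟨n, hn⟩ : ∃ n : ℕ, M < m + n := ⟨(M - m).toNat + 1, by omega⟩
  have h0 : g (m + n) = 0 := by
    by_contra h
    exact absurd (hM h) (by omega)
  have h := edist_le_range_sum_edist (fun j : ℕ => g (m + j)) n
  simp only [h0, Nat.cast_zero, add_zero, Nat.cast_add, Nat.cast_one, ← add_assoc] at h
  refine h.trans ((ENNReal.sum_le_tsum _).trans ?_)
  exact ENNReal.tsum_comp_le_tsum_of_injective (f := fun j : ℕ => m + (j : ℤ))
    (fun a b hab => by simpa using hab) (fun k => edist (g k) (g (k + 1)))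

lemma rpow_sub_rpow_le {a b s : ℝ} (ha : 0 ≤ a) (hab : a ≤ b) (hs : 1 ≤ s) :
    b ^ s - a ^ s ≤ s * (b ^ (s - 1) * (b - a)) := by
  rcases (ha.trans hab).eq_or_lt with rfl | hb
  · obtain rfl : a = 0 := le_antisymm hab ha
    simp
  have h := one_add_mul_self_le_rpow_one_add (s := a / b - 1)
    (by have := div_nonneg ha hb.le; linarith) hs
  rw [add_sub_cancel, Real.div_rpow ha hb.le, le_div_iff₀ (Real.rpow_pos_of_pos hb s)] at h
  have hb1 : b ^ s = b ^ (s - 1) * b := by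
    rw [← Real.rpow_add_one hb.ne', sub_add_cancel]
  have : (1 + s * (a / b - 1)) * b ^ s = b ^ s + s * (b ^ (s - 1) * (a - b)) := by
    rw [hb1]; field_simp
  linarith

lemma abs_rpow_sub_rpow_le {a b s : ℝ} (ha : 0 ≤ a) (hb : 0 ≤ b) (hs : 1 ≤ s) :
    |a ^ s - b ^ s| ≤ s * (a ^ (s - 1) * |a - b|) + s * (b ^ (s - 1) * |a - b|) := by
  wlog hab : a ≤ b generalizing a b
  · rw [abs_sub_comm, abs_sub_comm a b, add_comm]
    exact this hb ha (le_of_not_ge hab)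
  have h1 : a ^ s ≤ b ^ s := Real.rpow_le_rpow ha hab (by linarith)
  rw [abs_of_nonpos (by linarith), abs_of_nonpos (by linarith)]
  have := rpow_sub_rpow_le ha hab hs
  have h2 : 0 ≤ s * (a ^ (s - 1) * (b - a)) :=
    mul_nonneg (by linarith) (mul_nonneg (Real.rpow_nonneg ha _) (by linarith))
  rw [neg_sub, neg_sub]
  linarith

lemma edist_abs_rpow_le (a b : ℝ) {s : ℝ} (hs : 1 ≤ s) :
    edist (|a| ^ s) (|b| ^ s) ≤
      ENNReal.ofReal s * (ENNReal.ofReal (|a| ^ (s - 1)) * ENNReal.ofReal |b - a| +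
        ENNReal.ofReal (|b| ^ (s - 1)) * ENNReal.ofReal |b - a|) := by
  have ha := Real.rpow_nonneg (abs_nonneg a) (s - 1)
  have hb := Real.rpow_nonneg (abs_nonneg b) (s - 1)
  rw [edist_dist, Real.dist_eq, ← ENNReal.ofReal_mul ha, ← ENNReal.ofReal_mul hb,
    ← ENNReal.ofReal_add (by positivity) (by positivity), ← ENNReal.ofReal_mul (by linarith)]
  refine ENNReal.ofReal_le_ofReal
    ((abs_rpow_sub_rpow_le (abs_nonneg a) (abs_nonneg b) hs).trans ?_)
  have h : |(|a| - |b|)| ≤ |b - a| := abs_sub_comm a b ▸ abs_abs_sub_abs_le_abs_sub a b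
  rw [mul_add]
  gcongr

lemma adj_add_single {N : ℕ} (x : ZN N) (i : Fin N) : adj x (x + Pi.single i 1) := by
  unfold adj
  rw [Finset.sum_eq_single i] <;> simp +contextual

lemma tsum_grad_rpow_le_energy {N : ℕ} {p q : ℝ} (hp : 0 < p) (hq : 0 ≤ q) {a : ZN N → ℝ}
    (ha : ∀ x, 0 ≤ a x) (u : ZN N → ℝ) (i : Fin N) :
    ∑' x, ENNReal.ofReal |u (x + Pi.single i 1) - u x| ^ p ≤
      ENNReal.ofReal p * 2 * energy p q a u := by
  have hle : ∑' x : ZN N, ENNReal.ofReal (1 / p * |u (x + Pi.single i 1) - u x| ^ p) ≤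
      2 * energy p q a u := by
    unfold energy eInt
    rw [ENNReal.mul_div_cancel (by norm_num) (by norm_num)]
    refine le_trans ?_ (ENNReal.tsum_comp_le_tsum_of_injective
      (f := fun x : ZN N => (x, x + Pi.single i 1)) (fun x y h => (Prod.ext_iff.1 h).1) _)
    refine ENNReal.tsum_le_tsum fun x => ?_
    rw [if_pos (adj_add_single x i)]
    refine ENNReal.ofReal_le_ofReal ?_
    have := mul_nonneg (div_nonneg (ha x) hq)
      (Real.rpow_nonneg (abs_nonneg (grad u x (x + Pi.single i 1))) q)
    simpa [grad] using this
  rw [mul_assoc]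
  refine le_trans (le_of_eq ?_) (mul_le_mul_right hle _)
  rw [← ENNReal.tsum_mul_left]
  refine tsum_congr fun x => ?_
  rw [← ENNReal.ofReal_mul hp.le, ← mul_assoc, mul_one_div_cancel hp.ne', one_mul,
    ENNReal.ofReal_rpow_of_nonneg (abs_nonneg _) hp.le]

lemma abs_le_one_of_vsum_eq_one {N : ℕ} {r : ℝ} (hr : 0 < r) {u : ZN N → ℝ} (h : vsum r u = 1)
    (x : ZN N) : |u x| ≤ 1 := by
  have h1 : ENNReal.ofReal (|u x| ^ r) ≤ 1 :=
    h ▸ ENNReal.le_tsum (f := fun x => ENNReal.ofReal (|u x| ^ r)) x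
  rw [ENNReal.ofReal_le_one] at h1
  by_contra! h2
  exact absurd h1 (not_le.2 (Real.one_lt_rpow h2 hr))

lemma tsum_rpow_mul_grad_le {N : ℕ} {p r s : ℝ} (hp : 1 < p) (hr : 0 < r)
    (hrs : r ≤ s * p.conjExponent) {u : ZN N → ℝ} (h : vsum r u = 1)
    (e : ZN N ≃ ZN N) (G : ZN N → ℝ≥0∞) :
    ∑' x, ENNReal.ofReal (|u (e x)| ^ s) * G x ≤ (∑' x, G x ^ p) ^ (1 / p) := by
  have hc : p.conjExponent.HolderConjugate p := (Real.HolderConjugate.conjExponent hp).symm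
  refine (tsum_mul_le_Lp_mul_Lq hc _ _).trans ?_
  refine mul_le_of_le_one_left zero_le (ENNReal.rpow_le_one ?_ (by have := hc.pos; positivity))
  rw [e.tsum_eq (fun x => ENNReal.ofReal (|u x| ^ s) ^ p.conjExponent), ← h]
  refine ENNReal.tsum_le_tsum fun x => ?_
  rw [ENNReal.ofReal_rpow_of_nonneg (by positivity) hc.pos.le, ← Real.rpow_mul (abs_nonneg _)]
  exact ENNReal.ofReal_le_ofReal (Real.rpow_le_rpow_of_exponent_ge_of_imp (abs_nonneg _)
    (abs_le_one_of_vsum_eq_one hr h x) hrs (fun _ h0 => absurd h0 (hr.trans_le hrs).ne'))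

lemma one_le_tsum_edist {N : ℕ} (hN : 2 ≤ N) {r : ℝ} (hr : 0 < r) {u : ZN N → ℝ}
    (hu : (support u).Finite) (h : vsum r u = 1) :
    1 ≤ ∑' x : ZN N, ∑ i, edist (|u x| ^ (r * (N - 1) / N))
      (|u (x + Pi.single i 1)| ^ (r * (N - 1) / N)) := by
  have hN' : (2 : ℝ) ≤ N := by exact_mod_cast hN
  have hN1 : (0 : ℝ) < N - 1 := by linarith
  set s : ℝ := r * (N - 1) / N with hs
  have hs0 : 0 < s := by positivity
  set f : ZN N → ℝ≥0∞ := fun x => ∑ i, edist (|u x| ^ s) (|u (x + Pi.single i 1)| ^ s) with hf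
  have hline (x : ZN N) (i : Fin N) :
      ENNReal.ofReal (|u x| ^ s) ≤ ∑' k : ℤ, f (update x i k) := by
    have hfin : (support fun k : ℤ => |u (update x i k)| ^ s).Finite := by
      refine (hu.preimage (update_injective x i).injOn).subset fun k hk hk0 => hk ?_
      simp [hk0, hs0.ne']
    have h1 := edist_zero_le_tsum_edist _ hfin (x i)
    rw [update_eq_self, edist_dist, Real.dist_eq, sub_zero, abs_of_nonneg (by positivity)] at h1
    refine h1.trans (ENNReal.tsum_le_tsum fun k => ?_)
    have hup : update x i (k + 1) = update x i k + Pi.single i 1 := by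
      ext j
      rcases eq_or_ne j i with rfl | hj <;> simp [*]
    simp only [hf, hup]
    have hi := Finset.single_le_sum_of_canonicallyOrdered
      (f := fun j => edist (|u (update x i k)| ^ s) (|u (update x i k + Pi.single j 1)| ^ s))
      (Finset.mem_univ i)
    exact hi
  have hprod : 1 ≤ (∑' x, f x) ^ ((N : ℝ) / (N - 1)) := by
    rw [← h]
    refine le_trans (ENNReal.tsum_le_tsum fun x => ?_) (tsum_prod_tsum_update_rpow_le hN f)
    have hx : ENNReal.ofReal (|u x| ^ r) =
        ∏ _i : Fin N, ENNReal.ofReal (|u x| ^ s) ^ (1 / ((N : ℝ) - 1)) := by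
      rw [Finset.prod_const, Finset.card_univ, Fintype.card_fin, ← ENNReal.rpow_mul_natCast,
        ENNReal.ofReal_rpow_of_nonneg (by positivity) (by positivity),
        ← Real.rpow_mul (abs_nonneg _)]
      congr 2
      rw [hs]
      field_simp
    rw [hx]
    exact Finset.prod_le_prod' fun i _ => ENNReal.rpow_le_rpow (hline x i) (by positivity)
  by_contra! hlt
  exact absurd hprod (not_le.2 (ENNReal.rpow_lt_one hlt (by positivity)))

lemma one_le_mul_energy_rpow {N : ℕ} (hN : 2 ≤ N) {p q r : ℝ} (hp : 1 < p) (hpN : p < N)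
    (hq : 0 ≤ q) (hr : (N : ℝ) * p / (N - p) < r) {a : ZN N → ℝ} (ha : ∀ x, 0 ≤ a x)
    {u : ZN N → ℝ} (hu : (support u).Finite) (h : vsum r u = 1) :
    1 ≤ (N * (ENNReal.ofReal (r * (N - 1) / N) * 2)) *
      (ENNReal.ofReal p * 2 * energy p q a u) ^ (1 / p) := by
  have hN' : (2 : ℝ) ≤ N := by exact_mod_cast hN
  have hNp : 0 < (N : ℝ) - p := by linarith
  rw [div_lt_iff₀ hNp] at hr
  have hr0 : 0 < r := by
    by_contra! h0
    nlinarith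
  set s : ℝ := r * (N - 1) / N with hs
  have hs1 : 1 ≤ s := by
    rw [hs, le_div_iff₀ (by linarith)]
    nlinarith
  have hrs : r ≤ (s - 1) * p.conjExponent := by
    have hp1 : 0 < p - 1 := by linarith
    rw [Real.conjExponent, ← mul_div_assoc, le_div_iff₀ hp1, hs]
    have : (r * (N - 1) / N - 1) * p - r * (p - 1) = (r * (N - p) - N * p) / N := by
      field_simp; ring
    have : 0 ≤ (r * (N - p) - N * p) / (N : ℝ) := div_nonneg (by linarith) (by linarith)
    linarith
  set B := (ENNReal.ofReal p * 2 * energy p q a u) ^ (1 / p) with hB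
  have hdir (i : Fin N) :
      ∑' x : ZN N, edist (|u x| ^ s) (|u (x + Pi.single i 1)| ^ s) ≤
        ENNReal.ofReal s * (2 * B) := by
    refine (ENNReal.tsum_le_tsum fun x => edist_abs_rpow_le _ _ hs1).trans ?_
    rw [ENNReal.tsum_mul_left, ENNReal.tsum_add, two_mul]
    have hG : (∑' x, ENNReal.ofReal |u (x + Pi.single i 1) - u x| ^ p) ^ (1 / p) ≤ B :=
      ENNReal.rpow_le_rpow (tsum_grad_rpow_le_energy (by linarith) hq ha u i) (by positivity)
    gcongr
    · exact (tsum_rpow_mul_grad_le hp hr0 hrs h (Equiv.refl _) _).trans hG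
    · exact (tsum_rpow_mul_grad_le hp hr0 hrs h
        (Equiv.addRight (Pi.single i 1)) _).trans hG
  calc 1 ≤ _ := one_le_tsum_edist hN hr0 hu h
    _ = ∑ i, ∑' x : ZN N, edist (|u x| ^ s) (|u (x + Pi.single i 1)| ^ s) :=
      Summable.tsum_finsetSum fun _ _ => ENNReal.summable
    _ ≤ ∑ _i : Fin N, ENNReal.ofReal s * (2 * B) := Finset.sum_le_sum fun i _ => hdir i
    _ = _ := by simp [mul_assoc]

end DiscreteSobolev

/-- positivity of the constrained infimum
`S = inf { I(u) : u finitely supported, Σ_x |u(x)|^r = 1 }` for `r > p*`. -/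
theorem statement17 {N : ℕ} (hN : 2 ≤ N) (p q : ℝ) (hp : 1 < p) (hpN : p < (N : ℝ))
    (hpq : p < q) (pstar : ℝ) (hpstar : pstar = (N : ℝ) * p / ((N : ℝ) - p))
    (r : ℝ) (hr : pstar < r)
    (a : ZN N → ℝ) (ha : ∀ x, 0 ≤ a x) :
    0 < sInf { c : ℝ≥0∞ | ∃ u : ZN N → ℝ, (Function.support u).Finite ∧
        vsum r u = 1 ∧ energy p q a u = c } := by
  have hp0 : 0 < p := by linarith
  set K : ℝ≥0∞ := N * (ENNReal.ofReal (r * (N - 1) / N) * 2) with hK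
  have hKtop : K ≠ ∞ := by
    rw [hK]
    exact ENNReal.mul_ne_top (by simp) (ENNReal.mul_ne_top (by simp) (by simp))
  have hPtop : ENNReal.ofReal p * 2 ≠ ∞ := ENNReal.mul_ne_top (by simp) (by simp)
  have hpos : 0 < K⁻¹ ^ p / (ENNReal.ofReal p * 2) :=
    ENNReal.div_pos (ENNReal.rpow_pos_of_nonneg (ENNReal.inv_pos.2 hKtop) hp0.le).ne' hPtop
  refine hpos.trans_le (le_sInf ?_)
  rintro c ⟨u, hu, h, rfl⟩
  have hone := one_le_mul_energy_rpow hN hp hpN (hp0.trans hpq).le (hpstar ▸ hr) ha hu h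
  refine ENNReal.div_le_of_le_mul' ?_
  rw [← ENNReal.le_rpow_inv_iff hp0, inv_eq_one_div p]
  have hK0 : K ≠ 0 := by
    rintro h0
    rw [← hK, h0, zero_mul] at hone
    exact absurd hone (by simp)
  exact (ENNReal.inv_le_iff_le_mul (fun _ => hK0) (fun h => absurd h hKtop)).2 hone
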